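/- Let (c^(N))_{N≥2} be a family of conductances satisfying condition (LLN). For each N, let g_N : {1,…,N} → ℝ satisfy Δ^{c^(N)} g_N = −gap_N·g_N and g_N(1) = 1, let h_N(x) := cos(π·(x − 1/2)/N), let α_N := N²·gap_N, let τ₁^(N) := min{ x ∈ {1,…,N} : √(α_N)·r^(N)(1,x)/N ≥ π/4 } and τ₂^(N) := max{ x ∈ {1,…,N} : √(α_N)·r^(N)(1,x)/N ≤ 3π/4 } (with the immaterial conventions τ₁^(N) := N and τ₂^(N) := 1 if the respective sets are empty). Then lim_{N→∞} max_{τ₁^(N) ≤ x ≤ τ₂^(N)} |g_N(x) − h_N(x)| = 0 and lim_{N→∞} max_{max(2,τ₁^(N)) ≤ x ≤ τ₂^(N)} |N·c^(N)(x−1)·(g_N(x) − g_N(x−1)) − N·(h_N(x) − h_N(x−1))| = 0. -/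

import Mathlib

/-- The generator `Δ^c` of the random walk with conductances `c` on `⟦1, N⟧`. -/
def gen (N : ℕ) (c : ℕ → ℝ) (f : ℕ → ℝ) (x : ℕ) : ℝ :=
  (if x < N then c x * (f (x + 1) - f x) else 0) +
  (if 2 ≤ x then c (x - 1) * (f (x - 1) - f x) else 0)

/-- `lam` is an eigenvalue of `−Δ^c`. -/
def IsEigenvalue (N : ℕ) (c : ℕ → ℝ) (lam : ℝ) : Prop :=
  ∃ f : ℕ → ℝ, (∃ x ∈ Finset.Icc 1 N, f x ≠ 0) ∧
    ∀ x ∈ Finset.Icc 1 N, gen N c f x = -lam * f x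

/-- The spectral gap: the smallest strictly positive eigenvalue of `−Δ^c`. -/
noncomputable def spectralGap (N : ℕ) (c : ℕ → ℝ) : ℝ :=
  sInf {lam : ℝ | 0 < lam ∧ IsEigenvalue N c lam}

/-- `rsum r n m = Σ_{x=n}^{m-1} r(x)`. -/
def rsum (r : ℕ → ℝ) (n m : ℕ) : ℝ := ∑ x ∈ Finset.Ico n m, r x

/-- Condition (LLN): `(1/N)·sup_{1 ≤ n < m ≤ N} |r^{(N)}(n,m) − (m−n)| → 0`. -/
def LLN (r : ℕ → ℕ → ℝ) : Prop :=
  ∀ ε > (0 : ℝ), ∃ N₀ : ℕ, ∀ N ≥ N₀, ∀ n m : ℕ, 1 ≤ n → n < m → m ≤ N →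
    |rsum (r N) n m - ((m : ℝ) - (n : ℝ))| ≤ ε * N

/-- `h_N(x) = cos(π(x − 1/2)/N)`. -/
noncomputable def hfun (N : ℕ) (x : ℕ) : ℝ := Real.cos (Real.pi * ((x : ℝ) - 1/2) / N)

open Classical in
/-- `τ₁ = min{x ∈ ⟦1,N⟧ : √α·r(1,x)/N ≥ π/4}`, with convention `N` if the set is empty. -/
noncomputable def tau1 (N : ℕ) (r : ℕ → ℝ) (α : ℝ) : ℕ :=
  if h : ((Finset.Icc 1 N).filter
      (fun x => Real.pi / 4 ≤ Real.sqrt α * rsum r 1 x / N)).Nonempty then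
    ((Finset.Icc 1 N).filter
      (fun x => Real.pi / 4 ≤ Real.sqrt α * rsum r 1 x / N)).min' h
  else N

open Classical in
/-- `τ₂ = max{x ∈ ⟦1,N⟧ : √α·r(1,x)/N ≤ 3π/4}`, with convention `1` if the set is empty. -/
noncomputable def tau2 (N : ℕ) (r : ℕ → ℝ) (α : ℝ) : ℕ :=
  if h : ((Finset.Icc 1 N).filter
      (fun x => Real.sqrt α * rsum r 1 x / N ≤ 3 * Real.pi / 4)).Nonempty then
    ((Finset.Icc 1 N).filter
      (fun x => Real.sqrt α * rsum r 1 x / N ≤ 3 * Real.pi / 4)).max' h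
  else 1

theorem gron_aux (N : ℕ) (hN : 1 ≤ N) (ρ a U G V : ℕ → ℝ) (lam mu ε κ : ℝ)
    (hε0 : 0 ≤ ε)
    (hρ : ∀ i, i + 1 < N → 0 < ρ i)
    (hR : ∀ i < N, |∑ j ∈ Finset.range i, ρ j - (i : ℝ)| ≤ ε * N)
    (hU : ∀ i, U (i + 1) = U i - N * lam * a i)
    (hV : ∀ i, V (i + 1) = V i - N * mu * G i)
    (ha : ∀ i, a (i + 1) = a i + ρ i / N * U (i + 1))
    (hG : ∀ i, G (i + 1) = G i + V (i + 1) / N)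
    (hG1 : ∀ i, |G i| ≤ 1) (hV1 : ∀ i, |V i| ≤ 25)
    (hl0 : 0 ≤ lam) (hl1 : (N : ℝ) ^ 2 * lam ≤ 25)
    (hm0 : 0 ≤ mu) (hm1 : (N : ℝ) ^ 2 * mu ≤ 25)
    (hκ : (N : ℝ) ^ 2 * |lam - mu| ≤ κ) :
    (∀ i < N, |a i - G i| ≤ |a i - G i - (∑ j ∈ Finset.range i, ρ j - (i : ℝ)) * V i / N| + 25 * ε) ∧
    (∀ i < N, |U (i + 1) - V (i + 1)| ≤ |U i - V i| +
      25 / N * |a i - G i - (∑ j ∈ Finset.range i, ρ j - (i : ℝ)) * V i / N| +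
        (625 * ε + κ) / N) ∧
    (∀ i, i + 1 < N → |a (i + 1) - G (i + 1) -
        (∑ j ∈ Finset.range (i + 1), ρ j - ((i + 1 : ℕ) : ℝ)) * V (i + 1) / N| ≤
      |a i - G i - (∑ j ∈ Finset.range i, ρ j - (i : ℝ)) * V i / N| +
       ρ i / N * |U (i + 1) - V (i + 1)| + 25 * ε / N) := by
  have hNp : (0 : ℝ) < N := by exact_mod_cast hN
  have h1 : ∀ i < N, |a i - G i| ≤
      |a i - G i - (∑ j ∈ Finset.range i, ρ j - (i : ℝ)) * V i / N| + 25 * ε := by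
    intro i hi
    have h2 : |(∑ j ∈ Finset.range i, ρ j - (i : ℝ)) * V i / N| ≤ 25 * ε := by
      rw [abs_div, abs_mul, abs_of_pos hNp, div_le_iff₀ hNp]
      calc _ ≤ (ε * N) * 25 := mul_le_mul (hR i hi) (hV1 i) (abs_nonneg _) (by positivity)
        _ = _ := by ring
    have h3 := abs_add_le (a i - G i - (∑ j ∈ Finset.range i, ρ j - (i : ℝ)) * V i / N)
      ((∑ j ∈ Finset.range i, ρ j - (i : ℝ)) * V i / N)
    rw [sub_add_cancel] at h3
    linarith
  refine ⟨h1, ?_, ?_⟩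
  · intro i hi
    have e : U (i + 1) - V (i + 1) = (U i - V i) + (-(N * lam * (a i - G i)))
        + (-(N * (lam - mu) * G i)) := by rw [hU, hV]; ring
    have b1 : |(-(N * lam * (a i - G i)))| ≤ 25 / N * |a i - G i| := by
      rw [abs_neg, abs_mul, abs_of_nonneg (by positivity : 0 ≤ (N : ℝ) * lam)]
      apply mul_le_mul_of_nonneg_right _ (abs_nonneg _)
      rw [le_div_iff₀ hNp]; linarith [hl1]
    have b2 : |(-(N * (lam - mu) * G i))| ≤ κ / N := by
      rw [abs_neg, abs_mul, abs_mul, abs_of_pos hNp, le_div_iff₀ hNp]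
      calc _ = (N : ℝ) ^ 2 * |lam - mu| * |G i| := by ring
        _ ≤ (N : ℝ) ^ 2 * |lam - mu| * 1 := by gcongr; exact hG1 i
        _ ≤ κ := by linarith
    have h4 := h1 i hi
    have h5 : 25 / (N : ℝ) * |a i - G i| ≤ 25 / N * (|a i - G i - (∑ j ∈ Finset.range i, ρ j - (i : ℝ)) * V i / N| + 25 * ε) := by gcongr
    rw [e]
    refine (abs_add_three _ _ _).trans ?_
    have : 25 / (N : ℝ) * (25 * ε) + κ / N = (625 * ε + κ) / N := by ring
    linarith
  · intro i hi
    have e : a (i + 1) - G (i + 1) -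
        (∑ j ∈ Finset.range (i + 1), ρ j - ((i + 1 : ℕ) : ℝ)) * V (i + 1) / N =
        (a i - G i - (∑ j ∈ Finset.range i, ρ j - (i : ℝ)) * V i / N) +
        ρ i / N * (U (i + 1) - V (i + 1)) +
        (∑ j ∈ Finset.range i, ρ j - (i : ℝ)) * mu * G i := by
      rw [ha, hG, Finset.sum_range_succ, hV]
      push_cast
      field_simp
      ring
    rw [e]
    refine (abs_add_three _ _ _).trans ?_
    have b1 : |ρ i / N * (U (i + 1) - V (i + 1))| = ρ i / N * |U (i + 1) - V (i + 1)| := by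
      rw [abs_mul, abs_of_pos (div_pos (hρ i hi) hNp)]
    have b2 : |(∑ j ∈ Finset.range i, ρ j - (i : ℝ)) * mu * G i| ≤ 25 * ε / N := by
      rw [abs_mul, abs_mul, abs_of_nonneg hm0, le_div_iff₀ hNp]
      calc _ ≤ (ε * N) * mu * 1 * N := by
            gcongr
            · exact hR i (by omega)
            · exact hG1 i
        _ = ε * ((N : ℝ) ^ 2 * mu) := by ring
        _ ≤ ε * 25 := by gcongr
        _ = _ := by ring
    linarith

set_option maxHeartbeats 1000000 in
theorem gron (N : ℕ) (hN : 1 ≤ N) (ρ a U G V : ℕ → ℝ) (lam mu ε κ : ℝ)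
    (hε0 : 0 ≤ ε) (hε1 : ε ≤ 1)
    (hρ : ∀ i, i + 1 < N → 0 < ρ i)
    (hR : ∀ i < N, |∑ j ∈ Finset.range i, ρ j - (i : ℝ)| ≤ ε * N)
    (U0 : U 0 = 0) (V0 : V 0 = 0)
    (hU : ∀ i, U (i + 1) = U i - N * lam * a i)
    (hV : ∀ i, V (i + 1) = V i - N * mu * G i)
    (ha : ∀ i, a (i + 1) = a i + ρ i / N * U (i + 1))
    (hG : ∀ i, G (i + 1) = G i + V (i + 1) / N)
    (hG1 : ∀ i, |G i| ≤ 1) (hV1 : ∀ i, |V i| ≤ 25)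
    (hl0 : 0 ≤ lam) (hl1 : (N : ℝ) ^ 2 * lam ≤ 25)
    (hm0 : 0 ≤ mu) (hm1 : (N : ℝ) ^ 2 * mu ≤ 25)
    (hκ : (N : ℝ) ^ 2 * |lam - mu| ≤ κ) :
    ∀ i < N, |a i - G i| ≤ 20000 * Real.exp 27 * (ε + κ + |a 0 - G 0|) ∧
      |U (i + 1) - V (i + 1)| ≤ 20000 * Real.exp 27 * (ε + κ + |a 0 - G 0|) := by
  have hNp : (0 : ℝ) < N := by exact_mod_cast hN
  have hN1 : (1 : ℝ) ≤ N := by exact_mod_cast hN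
  obtain ⟨h1, h2, h3⟩ := gron_aux N hN ρ a U G V lam mu ε κ hε0 hρ hR hU hV ha hG hG1 hV1
    hl0 hl1 hm0 hm1 hκ
  set D : ℕ → ℝ := fun i =>
    |a i - G i - (∑ j ∈ Finset.range i, ρ j - (i : ℝ)) * V i / N| with hD
  set E : ℕ → ℝ := fun i => |U i - V i| with hE
  change ∀ i < N, |a i - G i| ≤ D i + 25 * ε at h1
  change ∀ i < N, E (i + 1) ≤ E i + 25 / N * D i + (625 * ε + κ) / N at h2
  change ∀ i, i + 1 < N → D (i + 1) ≤ D i + ρ i / N * E (i + 1) + 25 * ε / N at h3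
  have D0 : ∀ i, 0 ≤ D i := fun i => abs_nonneg _
  have E0 : ∀ i, 0 ≤ E i := fun i => abs_nonneg _
  have hκ0 : 0 ≤ κ := le_trans (by positivity) hκ
  have hD00 : D 0 = |a 0 - G 0| := by simp [hD, V0]
  have hE00 : E 0 = 0 := by simp [hE, V0, U0]
  set d := |a 0 - G 0| with hd
  have hd0 : 0 ≤ d := abs_nonneg _
  set b := 650 * ε + κ with hb
  have hb0 : 0 ≤ b := by positivity
  have key : ∀ i < N, D i + E i ≤
      Real.exp ((∑ j ∈ Finset.range i, ρ j) / N + 25 * i / N) * (d + b * i / N) := by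
    intro i
    induction i with
    | zero => intro _; simp [hD00, hE00]
    | succ i ih =>
      intro hi
      have ih := ih (by omega)
      have r0 : 0 < ρ i / N := div_pos (hρ i hi) hNp
      have hA : 0 ≤ 25 / (N : ℝ) := by positivity
      have q1 := h2 i (by omega)
      have q2 := h3 i hi
      have hbN : (625 * ε + κ) / N + 25 * ε / N = b / N := by rw [hb]; ring
      have hp1 : 0 ≤ 25 * ε / (N : ℝ) := by positivity
      have hp2 : 0 ≤ b / (N : ℝ) := by positivity
      have step : D (i + 1) + E (i + 1) ≤
          (1 + ρ i / N) * (1 + 25 / N) * (D i + E i + b / N) := by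
        have s1 : D (i + 1) + E (i + 1) ≤ D i + (1 + ρ i / N) * E (i + 1) + 25 * ε / N := by
          linarith
        have s2 : (1 + ρ i / N) * E (i + 1) ≤
            (1 + ρ i / N) * (E i + 25 / N * D i + (625 * ε + κ) / N) := by gcongr
        have s3 : (1 + ρ i / N) * (E i + 25 / N * D i + (625 * ε + κ) / N) + D i + 25 * ε / N
            ≤ (1 + ρ i / N) * (E i + (1 + 25 / N) * D i + b / N) := by
          rw [← hbN]
          nlinarith [mul_nonneg r0.le (D0 i), mul_nonneg r0.le hp1]
        have s4 : E i + (1 + 25 / N) * D i + b / N ≤ (1 + 25 / N) * (D i + E i + b / N) := by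
          nlinarith [mul_nonneg hA (E0 i), mul_nonneg hA hp2]
        have s5 := mul_le_mul_of_nonneg_left s4 (by positivity : 0 ≤ 1 + ρ i / N)
        linarith
      have x1 : 1 + ρ i / N ≤ Real.exp (ρ i / N) := by
        linarith [Real.add_one_le_exp (ρ i / N)]
      have x2 : 1 + 25 / (N : ℝ) ≤ Real.exp (25 / N) := by
        linarith [Real.add_one_le_exp (25 / (N : ℝ))]
      have se : (∑ j ∈ Finset.range i, ρ j) / N + 25 * i / N ≥ 0 := by
        have : 0 ≤ ∑ j ∈ Finset.range i, ρ j := Finset.sum_nonneg (fun j hj => by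
          have := Finset.mem_range.1 hj
          exact (hρ j (by omega)).le)
        positivity
      have oe := Real.one_le_exp se
      calc D (i + 1) + E (i + 1) ≤ (1 + ρ i / N) * (1 + 25 / N) * (D i + E i + b / N) := step
        _ ≤ Real.exp (ρ i / N) * Real.exp (25 / N) *
            (Real.exp ((∑ j ∈ Finset.range i, ρ j) / N + 25 * i / N) * (d + b * i / N) +
              Real.exp ((∑ j ∈ Finset.range i, ρ j) / N + 25 * i / N) * (b / N)) := by
            have : 0 ≤ D i + E i + b / N := by have := D0 i; have := E0 i; positivity
            gcongr
            nlinarith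
        _ = _ := by
            have : (∑ j ∈ Finset.range (i + 1), ρ j) / N + 25 * ((i + 1 : ℕ) : ℝ) / N =
              ρ i / N + 25 / N + ((∑ j ∈ Finset.range i, ρ j) / N + 25 * i / N) := by
              rw [Finset.sum_range_succ]; push_cast; ring
            rw [this, Real.exp_add (_ + _), Real.exp_add (ρ i / N)]
            push_cast; ring
  intro i hi
  have hiN : (i : ℝ) ≤ N := by exact_mod_cast hi.le
  have hW : D i + E i ≤ Real.exp 27 * (d + b) := by
    refine (key i hi).trans ?_
    have hs : (∑ j ∈ Finset.range i, ρ j) / N ≤ 2 := by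
      rw [div_le_iff₀ hNp]
      have := (abs_le.1 (hR i hi)).2
      nlinarith
    have h25 : 25 * (i : ℝ) / N ≤ 25 := by
      rw [div_le_iff₀ hNp]; linarith
    have hbi : b * (i : ℝ) / N ≤ b := by
      rw [div_le_iff₀ hNp]; gcongr
    have : 0 ≤ b * (i : ℝ) / N := by positivity
    gcongr
    linarith
  have e1 : 1 ≤ Real.exp 27 := Real.one_le_exp (by norm_num)
  have q1 := h1 i hi
  have q2 := h2 i hi
  have hDi := D0 i
  have hEi := E0 i
  have t1 : 25 / (N : ℝ) * D i ≤ 25 * D i := by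
    gcongr; exact div_le_self (by norm_num) hN1
  have t2 : (625 * ε + κ) / N ≤ 625 * ε + κ := div_le_self (by positivity) hN1
  have p1 : ε ≤ Real.exp 27 * ε := le_mul_of_one_le_left (by assumption) e1
  have p2 : κ ≤ Real.exp 27 * κ := le_mul_of_one_le_left (by assumption) e1
  have p3 : d ≤ Real.exp 27 * d := le_mul_of_one_le_left (by assumption) e1
  have hW' : D i + E i ≤ 650 * (Real.exp 27 * ε) + Real.exp 27 * κ + Real.exp 27 * d := by
    rw [hb] at hW; linarith
  have q3 : E (i + 1) ≤ 25 * (D i + E i) + 625 * ε + κ := by linarith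
  constructor
  · linarith
  · change E (i + 1) ≤ _
    linarith

/-- shooting solution -/
noncomputable def shoot (N : ℕ) (ρ : ℕ → ℝ) (lam : ℝ) : ℕ → ℝ × ℝ
  | 0 => (1, 0)
  | i + 1 => ((shoot N ρ lam i).1 + ρ i / N * ((shoot N ρ lam i).2 - N * lam * (shoot N ρ lam i).1),
      (shoot N ρ lam i).2 - N * lam * (shoot N ρ lam i).1)

theorem shoot_cont (N : ℕ) (ρ : ℕ → ℝ) (i : ℕ) : Continuous (fun lam => shoot N ρ lam i) := by
  induction i with
  | zero => simp only [shoot]; fun_prop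
  | succ i ih => simp only [shoot]; fun_prop

theorem shoot_of_eig (N : ℕ) (hN : 2 ≤ N) (c f : ℕ → ℝ) (lam : ℝ)
    (hc : ∀ x, 1 ≤ x → x ≤ N - 1 → 0 < c x)
    (hf : ∀ x ∈ Finset.Icc 1 N, gen N c f x = -lam * f x) :
    (∀ i < N, f (i + 1) = f 1 * (shoot N (fun i => 1 / c (i + 1)) lam i).1 ∧
      (N : ℝ) * (if i = 0 then 0 else c i * (f (i + 1) - f i)) =
        f 1 * (shoot N (fun i => 1 / c (i + 1)) lam i).2) ∧
    f 1 * (shoot N (fun i => 1 / c (i + 1)) lam N).2 = 0 := by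
  have hNp : (0 : ℝ) < N := by exact_mod_cast (by omega : 0 < N)
  have hfl : ∀ i < N, (if i + 1 < N then c (i + 1) * (f (i + 2) - f (i + 1)) else 0) =
      (if i = 0 then 0 else c i * (f (i + 1) - f i)) - lam * f (i + 1) := by
    intro i hi
    have := hf (i + 1) (Finset.mem_Icc.2 ⟨by omega, by omega⟩)
    unfold gen at this
    rcases Nat.eq_zero_or_pos i with h0 | h0
    · subst h0; simp at this ⊢; linarith
    · rw [if_pos (by omega : 2 ≤ i + 1)] at this
      rw [if_neg (by omega : ¬ i = 0)]
      simp only [Nat.add_sub_cancel] at this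
      linarith
  have main : ∀ i < N, f (i + 1) = f 1 * (shoot N (fun i => 1 / c (i + 1)) lam i).1 ∧
      (N : ℝ) * (if i = 0 then 0 else c i * (f (i + 1) - f i)) =
        f 1 * (shoot N (fun i => 1 / c (i + 1)) lam i).2 := by
    intro i
    induction i with
    | zero => intro _; simp [shoot]
    | succ i ih =>
      intro hi
      obtain ⟨i1, i2⟩ := ih (by omega)
      have h := hfl i (by omega)
      rw [if_pos hi] at h
      have cp : 0 < c (i + 1) := hc _ (by omega) (by omega)
      have hfx : f (i + 2) = f (i + 1) + 1 / c (i + 1) * (c (i + 1) * (f (i + 2) - f (i + 1))) := by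
        field_simp; ring
      have hfl2 : (N : ℝ) * (c (i + 1) * (f (i + 2) - f (i + 1))) =
          f 1 * ((shoot N (fun i => 1 / c (i + 1)) lam i).2 -
            N * lam * (shoot N (fun i => 1 / c (i + 1)) lam i).1) := by
        rw [h, mul_sub, i2, i1]; ring
      constructor
      · rw [show i + 1 + 1 = i + 2 from rfl, hfx, i1]
        simp only [shoot]
        rw [mul_add, ← mul_assoc (f 1) (_ / _), mul_comm (f 1) (_ / _), mul_assoc (_ / _) (f 1),
          ← hfl2, ← i1]
        field_simp
      · rw [if_neg (by omega)]
        exact hfl2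
  refine ⟨main, ?_⟩
  obtain ⟨M, rfl⟩ : ∃ M, N = M + 1 := ⟨N - 1, by omega⟩
  obtain ⟨i1, i2⟩ := main M (by omega)
  have h := hfl M (by omega)
  rw [if_neg (by omega)] at h
  simp only [shoot] at i1 i2 ⊢
  rw [mul_sub, ← i2]
  have : f 1 * (((M + 1 : ℕ) : ℝ) * lam * (shoot (M + 1) (fun i => 1 / c (i + 1)) lam M).1) =
    ((M + 1 : ℕ) : ℝ) * lam * f (M + 1) := by rw [i1]; ring
  rw [this]
  linear_combination (-((M + 1 : ℕ) : ℝ)) * h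

theorem eig_of_shoot (N : ℕ) (hN : 2 ≤ N) (c : ℕ → ℝ) (lam : ℝ)
    (hc : ∀ x, 1 ≤ x → x ≤ N - 1 → 0 < c x)
    (h : (shoot N (fun i => 1 / c (i + 1)) lam N).2 = 0) : IsEigenvalue N c lam := by
  have hNp : (0 : ℝ) < N := by exact_mod_cast (by omega : 0 < N)
  refine ⟨fun x => (shoot N (fun i => 1 / c (i + 1)) lam (x - 1)).1,
    ⟨1, Finset.mem_Icc.2 ⟨le_rfl, by omega⟩, by simp [shoot]⟩, ?_⟩
  intro x hx
  obtain ⟨hx1, hx2⟩ := Finset.mem_Icc.1 hx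
  obtain ⟨i, rfl⟩ : ∃ i, x = i + 1 := ⟨x - 1, by omega⟩
  have A : (if i + 1 < N then c (i + 1) * ((shoot N (fun i => 1 / c (i + 1)) lam (i + 1)).1 -
      (shoot N (fun i => 1 / c (i + 1)) lam i).1) else 0) =
      (shoot N (fun i => 1 / c (i + 1)) lam (i + 1)).2 / N := by
    split_ifs with h1
    · have cp : 0 < c (i + 1) := hc _ (by omega) (by omega)
      simp only [shoot]
      field_simp
      ring
    · rw [show i + 1 = N by omega, h]; simp
  have B : (if 2 ≤ i + 1 then c i * ((shoot N (fun i => 1 / c (i + 1)) lam (i - 1)).1 -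
      (shoot N (fun i => 1 / c (i + 1)) lam i).1) else 0) =
      -(shoot N (fun i => 1 / c (i + 1)) lam i).2 / N := by
    rcases i with _ | j
    · simp [shoot]
    · rw [if_pos (by omega)]
      have cp : 0 < c (j + 1) := hc _ (by omega) (by omega)
      simp only [shoot, Nat.add_sub_cancel]
      field_simp
      ring
  unfold gen
  simp only [Nat.add_sub_cancel]
  rw [A, B]
  simp only [shoot]
  field_simp
  ring

theorem shoot_close (N : ℕ) (hN : 1 ≤ N) (ρ : ℕ → ℝ) (θ lam ε κ : ℝ)
    (hε0 : 0 ≤ ε) (hε1 : ε ≤ 1)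
    (hρ : ∀ i, i + 1 < N → 0 < ρ i)
    (hR : ∀ i < N, |∑ j ∈ Finset.range i, ρ j - (i : ℝ)| ≤ ε * N)
    (hθ0 : 0 ≤ θ) (hθ : N * θ ≤ 5)
    (hl0 : 0 ≤ lam) (hl1 : (N : ℝ) ^ 2 * lam ≤ 25)
    (hκ : (N : ℝ) ^ 2 * |lam - 4 * Real.sin (θ / 2) ^ 2| ≤ κ) :
    ∀ i < N, |(shoot N ρ lam i).1 - Real.cos (θ * (i + 1 / 2))| ≤
        20000 * Real.exp 27 * (ε + κ + 5 / N) ∧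
      |(shoot N ρ lam (i + 1)).2 - (-(2 * N * Real.sin (θ / 2) * Real.sin (θ * ((i + 1 : ℕ) : ℝ))))| ≤
        20000 * Real.exp 27 * (ε + κ + 5 / N) := by
  have hNp : (0 : ℝ) < N := by exact_mod_cast hN
  have hs : |Real.sin (θ / 2)| ≤ θ / 2 := by
    have := Real.abs_sin_sub_sin_le (θ / 2) 0
    simpa [abs_of_nonneg (by positivity : 0 ≤ θ / 2)] using this
  have hNs : |2 * N * Real.sin (θ / 2)| ≤ 5 := by
    rw [abs_mul, abs_of_pos (by positivity)]
    nlinarith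
  have h := gron N hN ρ (fun i => (shoot N ρ lam i).1) (fun i => (shoot N ρ lam i).2)
    (fun i => Real.cos (θ * (i + 1 / 2)))
    (fun i => -(2 * N * Real.sin (θ / 2) * Real.sin (θ * (i : ℝ))))
    lam (4 * Real.sin (θ / 2) ^ 2) ε κ hε0 hε1 hρ hR (by simp [shoot]) (by simp)
    (fun i => by simp [shoot]) ?_ (fun i => by simp [shoot]) ?_
    (fun i => Real.abs_cos_le_one _) ?_ hl0 hl1 (by positivity) ?_ hκ
  · intro i hi
    have hd : |(shoot N ρ lam 0).1 - Real.cos (θ * ((0 : ℕ) + 1 / 2))| ≤ 5 / N := by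
      have := Real.abs_cos_sub_cos_le 0 (θ / 2)
      rw [Real.cos_zero, zero_sub, abs_neg, abs_of_nonneg (by positivity : 0 ≤ θ / 2)] at this
      have e : θ * (((0 : ℕ) : ℝ) + 1 / 2) = θ / 2 := by push_cast; ring
      rw [e]
      simp only [shoot]
      refine this.trans ?_
      rw [le_div_iff₀ hNp]
      nlinarith
    have hC : 20000 * Real.exp 27 * (ε + κ + |(shoot N ρ lam 0).1 - Real.cos (θ * ((0 : ℕ) + 1 / 2))|)
      ≤ 20000 * Real.exp 27 * (ε + κ + 5 / N) := by gcongr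
    exact ⟨(h i hi).1.trans hC, (h i hi).2.trans hC⟩
  · intro i
    have e1 : θ * ((i + 1 : ℕ) : ℝ) = θ * (i + 1 / 2) + θ / 2 := by push_cast; ring
    have e2 : θ * (i : ℝ) = θ * (i + 1 / 2) - θ / 2 := by ring
    rw [e1, e2, Real.sin_add, Real.sin_sub]
    ring
  · intro i
    have e1 : θ * (((i + 1 : ℕ) : ℝ) + 1 / 2) = θ * ((i + 1 : ℕ) : ℝ) + θ / 2 := by ring
    have e2 : θ * ((i : ℝ) + 1 / 2) = θ * ((i + 1 : ℕ) : ℝ) - θ / 2 := by push_cast; ring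
    rw [e1, e2, Real.cos_add, Real.cos_sub]
    field_simp
    ring
  · intro i
    rw [abs_neg, abs_mul]
    nlinarith [Real.abs_sin_le_one (θ * (i : ℝ)), abs_nonneg (Real.sin (θ * (i : ℝ)))]
  · have : (N : ℝ) ^ 2 * (4 * Real.sin (θ / 2) ^ 2) = |2 * N * Real.sin (θ / 2)| ^ 2 := by
      rw [sq_abs]; ring
    rw [this]
    nlinarith [abs_nonneg (2 * N * Real.sin (θ / 2))]

theorem U_sign (N : ℕ) (hN : 2 ≤ N) (ρ : ℕ → ℝ) (θ δ ε : ℝ)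
    (hε0 : 0 ≤ ε) (hε1 : ε ≤ 1) (hδ0 : 0 < δ) (hδ1 : δ < 1)
    (hρ : ∀ i, i + 1 < N → 0 < ρ i)
    (hR : ∀ i < N, |∑ j ∈ Finset.range i, ρ j - (i : ℝ)| ≤ ε * N)
    (hη : 20000 * Real.exp 27 * (ε + 0 + 5 / N) < Real.sin δ / 2) :
    (0 < θ → N * θ ≤ Real.pi - δ → (shoot N ρ (4 * Real.sin (θ / 2) ^ 2) N).2 < 0) ∧
    (N * θ = Real.pi + δ → 0 < (shoot N ρ (4 * Real.sin (θ / 2) ^ 2) N).2) := by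
  have hNp : (0 : ℝ) < N := by exact_mod_cast (by omega : 0 < N)
  have hN2 : (2 : ℝ) ≤ N := by exact_mod_cast hN
  have p3 := Real.pi_gt_three
  have p4 := Real.pi_lt_d2
  have sd0 : 0 < Real.sin δ := Real.sin_pos_of_pos_of_lt_pi hδ0 (by linarith)
  have common : 0 < θ → N * θ ≤ Real.pi + δ →
      0 < Real.sin (θ / 2) ∧ (1 ≤ N * θ → 1 / 2 ≤ 2 * N * Real.sin (θ / 2)) ∧
      ∀ i < N, |(shoot N ρ (4 * Real.sin (θ / 2) ^ 2) i).1 - Real.cos (θ * (i + 1 / 2))| <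
        Real.sin δ / 2 ∧
      |(shoot N ρ (4 * Real.sin (θ / 2) ^ 2) (i + 1)).2 -
        (-(2 * N * Real.sin (θ / 2) * Real.sin (θ * ((i + 1 : ℕ) : ℝ))))| < Real.sin δ / 2 := by
    intro h0 h1
    have hθ2 : θ / 2 ≤ Real.pi / 2 := by nlinarith
    have hsl : Real.sin (θ / 2) < θ / 2 := Real.sin_lt (by positivity)
    have hs0 : 0 < Real.sin (θ / 2) := Real.sin_pos_of_pos_of_lt_pi (by positivity) (by linarith)
    refine ⟨hs0, ?_, ?_⟩
    · intro h
      have := Real.mul_le_sin (by positivity) hθ2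
      have h2 : 1 / 2 ≤ 2 / Real.pi := by
        rw [div_le_div_iff₀ (by norm_num) Real.pi_pos]; linarith
      have h3 : 1 / 2 * (θ / 2) ≤ Real.sin (θ / 2) :=
        le_trans (mul_le_mul_of_nonneg_right h2 (by positivity)) this
      nlinarith
    · have hb : (N : ℝ) ^ 2 * (4 * Real.sin (θ / 2) ^ 2) ≤ 25 := by
        have h5 : 2 * N * Real.sin (θ / 2) ≤ 5 := by nlinarith
        have h6 : 0 ≤ 2 * N * Real.sin (θ / 2) := by positivity
        nlinarith
      have := shoot_close N (by omega) ρ θ (4 * Real.sin (θ / 2) ^ 2) ε 0 hε0 hε1 hρ hR h0.le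
        (by linarith) (by positivity) hb (by simp)
      exact fun i hi => ⟨(this i hi).1.trans_lt hη, (this i hi).2.trans_lt hη⟩
  constructor
  · intro h0 h1
    obtain ⟨hs0, hs1, hcl⟩ := common h0 (by linarith)
    by_cases hsm : N * θ ≤ 1
    · have hpos : ∀ i < N, 0 < (shoot N ρ (4 * Real.sin (θ / 2) ^ 2) i).1 := by
        intro i hi
        have h2 := (abs_lt.1 (hcl i hi).1).1
        have hiN : (i : ℝ) + 1 ≤ N := by exact_mod_cast hi
        have hx : θ * ((i : ℝ) + 1 / 2) ≤ 1 := by nlinarith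
        have hx0 : 0 ≤ θ * ((i : ℝ) + 1 / 2) := by positivity
        have h3 := Real.one_sub_sq_div_two_le_cos (x := θ * ((i : ℝ) + 1 / 2))
        have := Real.sin_le_one δ
        nlinarith
      have hneg : ∀ i, i + 1 ≤ N → (shoot N ρ (4 * Real.sin (θ / 2) ^ 2) (i + 1)).2 < 0 := by
        intro i
        induction i with
        | zero => intro _; simp only [shoot]; have : 0 < N * (4 * Real.sin (θ / 2) ^ 2) := by positivity
                  linarith
        | succ i ih =>
          intro hi
          have a1 := ih (by omega)
          have a2 := hpos (i + 1) (by omega)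
          have : 0 < N * (4 * Real.sin (θ / 2) ^ 2) * (shoot N ρ (4 * Real.sin (θ / 2) ^ 2) (i + 1)).1 := by
            positivity
          rw [shoot]
          simp only []
          linarith
      have := hneg (N - 1) (by omega)
      rwa [Nat.sub_add_cancel (by omega)] at this
    · push Not at hsm
      have h2 := (abs_lt.1 (hcl (N - 1) (by omega)).2).2
      rw [Nat.sub_add_cancel (by omega)] at h2
      have h3 : Real.sin δ ≤ Real.sin (θ * N) := by
        by_cases hq : θ * N ≤ Real.pi / 2
        · exact Real.sin_le_sin_of_le_of_le_pi_div_two (by linarith) hq (by linarith)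
        · rw [← Real.sin_pi_sub (θ * N)]
          exact Real.sin_le_sin_of_le_of_le_pi_div_two (by linarith) (by linarith) (by linarith)
      have h4 := hs1 hsm.le
      nlinarith
  · intro h1
    have h0 : 0 < θ := by
      by_contra hh
      push Not at hh
      nlinarith
    obtain ⟨hs0, hs1, hcl⟩ := common h0 (by linarith)
    have h2 := (abs_lt.1 (hcl (N - 1) (by omega)).2).1
    rw [Nat.sub_add_cancel (by omega)] at h2
    have h3 : Real.sin (θ * N) = - Real.sin δ := by
      rw [mul_comm, h1, add_comm, Real.sin_add_pi]
    have h4 := hs1 (by linarith)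
    rw [h3] at h2
    nlinarith

theorem gap_bounds (N : ℕ) (hN : 2 ≤ N) (c : ℕ → ℝ) (δ ε : ℝ)
    (hε0 : 0 ≤ ε) (hε1 : ε ≤ 1) (hδ0 : 0 < δ) (hδ1 : δ < 1)
    (hc : ∀ x, 1 ≤ x → x ≤ N - 1 → 0 < c x)
    (hR : ∀ i < N, |∑ j ∈ Finset.range i, 1 / c (j + 1) - (i : ℝ)| ≤ ε * N)
    (hη : 20000 * Real.exp 27 * (ε + 0 + 5 / N) < Real.sin δ / 2) :
    4 * Real.sin ((Real.pi - δ) / N / 2) ^ 2 ≤ spectralGap N c ∧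
    spectralGap N c ≤ 4 * Real.sin ((Real.pi + δ) / N / 2) ^ 2 := by
  have hNp : (0 : ℝ) < N := by exact_mod_cast (by omega : 0 < N)
  have hN2 : (2 : ℝ) ≤ N := by exact_mod_cast hN
  have p3 := Real.pi_gt_three
  have p4 := Real.pi_lt_d2
  have hρ : ∀ i, i + 1 < N → 0 < (fun i => 1 / c (i + 1)) i := fun i hi =>
    one_div_pos.2 (hc _ (by omega) (by omega))
  have sgn := fun θ => U_sign N hN (fun i => 1 / c (i + 1)) θ δ ε hε0 hε1 hδ0 hδ1 hρ hR hη
  have t1 : 0 < (Real.pi - δ) / N / 2 := by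
    have : 0 < Real.pi - δ := by linarith
    positivity
  have t12 : (Real.pi - δ) / N / 2 ≤ (Real.pi + δ) / N / 2 := by gcongr; linarith
  have t2 : (Real.pi + δ) / N / 2 ≤ Real.pi / 2 := by
    rw [div_div, div_le_div_iff₀ (by positivity) (by norm_num)]; nlinarith
  have s1 : 0 < Real.sin ((Real.pi - δ) / N / 2) :=
    Real.sin_pos_of_pos_of_lt_pi t1 (by linarith)
  have s12 : Real.sin ((Real.pi - δ) / N / 2) ≤ Real.sin ((Real.pi + δ) / N / 2) :=
    Real.sin_le_sin_of_le_of_le_pi_div_two (by linarith) t2 t12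
  have l12 : 4 * Real.sin ((Real.pi - δ) / N / 2) ^ 2 ≤ 4 * Real.sin ((Real.pi + δ) / N / 2) ^ 2 := by
    gcongr
  have u1 := (sgn ((Real.pi - δ) / N)).1 (by linarith) (by field_simp; exact le_rfl)
  have u2 := (sgn ((Real.pi + δ) / N)).2 (by field_simp)
  have hcont : Continuous (fun lam => (shoot N (fun i => 1 / c (i + 1)) lam N).2) :=
    (shoot_cont N _ N).snd
  obtain ⟨lam, ⟨hl1, hl2⟩, hl3⟩ := intermediate_value_Icc l12 hcont.continuousOn ⟨u1.le, u2.le⟩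
  have hmem : lam ∈ {lam : ℝ | 0 < lam ∧ IsEigenvalue N c lam} :=
    ⟨lt_of_lt_of_le (by positivity) hl1, eig_of_shoot N hN c lam hc hl3⟩
  constructor
  · apply le_csInf ⟨lam, hmem⟩
    rintro nu ⟨hnu, f, ⟨x, hx, hfx⟩, hf⟩
    by_contra hlt
    push Not at hlt
    obtain ⟨f1, f2⟩ := shoot_of_eig N hN c f nu hc hf
    have hf1 : f 1 ≠ 0 := by
      intro h
      obtain ⟨hx1, hx2⟩ := Finset.mem_Icc.1 hx
      have := (f1 (x - 1) (by omega)).1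
      rw [Nat.sub_add_cancel hx1, h, zero_mul] at this
      exact hfx this
    have hU := (mul_eq_zero.1 f2).resolve_left hf1
    have hsq : Real.sqrt nu ^ 2 = nu := Real.sq_sqrt hnu.le
    have hsp : 0 < Real.sqrt nu := Real.sqrt_pos.2 hnu
    have hlt2 : Real.sqrt nu / 2 < Real.sin ((Real.pi - δ) / N / 2) := by
      by_contra hh
      push Not at hh
      nlinarith
    have hle1 := Real.sin_le_one ((Real.pi - δ) / N / 2)
    set θ := 2 * Real.arcsin (Real.sqrt nu / 2) with hθ
    have hsθ : Real.sin (θ / 2) = Real.sqrt nu / 2 := by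
      rw [hθ, mul_div_cancel_left₀ _ (by norm_num : (2 : ℝ) ≠ 0)]
      exact Real.sin_arcsin (by linarith) (by linarith)
    have hnuθ : 4 * Real.sin (θ / 2) ^ 2 = nu := by rw [hsθ]; linarith
    have hθ0 : 0 < θ := by
      have : 0 < Real.arcsin (Real.sqrt nu / 2) := Real.arcsin_pos.2 (by positivity)
      positivity
    have hθ1 : N * θ ≤ Real.pi - δ := by
      have : Real.arcsin (Real.sqrt nu / 2) < (Real.pi - δ) / N / 2 := by
        rw [Real.arcsin_lt_iff_lt_sin ⟨by linarith, by linarith⟩ ⟨by linarith, by linarith⟩]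
        exact hlt2
      have h2 : θ ≤ (Real.pi - δ) / N := by linarith
      rw [le_div_iff₀ hNp] at h2
      linarith
    have := (sgn θ).1 hθ0 hθ1
    rw [hnuθ] at this
    linarith
  · exact (csInf_le ⟨0, fun y hy => hy.1.le⟩ hmem).trans hl2

theorem gap_close (N : ℕ) (hN : 2 ≤ N) (c : ℕ → ℝ) (δ ε : ℝ)
    (hε0 : 0 ≤ ε) (hε1 : ε ≤ 1) (hδ0 : 0 < δ) (hδ1 : δ < 1)
    (hc : ∀ x, 1 ≤ x → x ≤ N - 1 → 0 < c x)
    (hR : ∀ i < N, |∑ j ∈ Finset.range i, 1 / c (j + 1) - (i : ℝ)| ≤ ε * N)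
    (hη : 20000 * Real.exp 27 * (ε + 0 + 5 / N) < Real.sin δ / 2) :
    0 ≤ spectralGap N c ∧ (N : ℝ) ^ 2 * spectralGap N c ≤ 25 ∧
    (N : ℝ) ^ 2 * |spectralGap N c - 4 * Real.sin (Real.pi / N / 2) ^ 2| ≤ 16 * δ := by
  have hNp : (0 : ℝ) < N := by exact_mod_cast (by omega : 0 < N)
  have hN2 : (2 : ℝ) ≤ N := by exact_mod_cast hN
  have p3 := Real.pi_gt_three
  have p4 := Real.pi_lt_d2
  obtain ⟨g1, g2⟩ := gap_bounds N hN c δ ε hε0 hε1 hδ0 hδ1 hc hR hη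
  have t1 : 0 < (Real.pi - δ) / N / 2 := by
    have : 0 < Real.pi - δ := by linarith
    positivity
  have t12 : (Real.pi - δ) / N / 2 ≤ Real.pi / N / 2 := by gcongr; linarith
  have t23 : Real.pi / N / 2 ≤ (Real.pi + δ) / N / 2 := by gcongr; linarith
  have t2 : (Real.pi + δ) / N / 2 ≤ Real.pi / 2 := by
    rw [div_div, div_le_div_iff₀ (by positivity) (by norm_num)]; nlinarith
  have s1 : 0 < Real.sin ((Real.pi - δ) / N / 2) :=
    Real.sin_pos_of_pos_of_lt_pi t1 (by linarith)
  have s12 : Real.sin ((Real.pi - δ) / N / 2) ≤ Real.sin (Real.pi / N / 2) :=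
    Real.sin_le_sin_of_le_of_le_pi_div_two (by linarith) (by linarith) t12
  have s23 : Real.sin (Real.pi / N / 2) ≤ Real.sin ((Real.pi + δ) / N / 2) :=
    Real.sin_le_sin_of_le_of_le_pi_div_two (by linarith) t2 t23
  have l12 : 4 * Real.sin ((Real.pi - δ) / N / 2) ^ 2 ≤ 4 * Real.sin (Real.pi / N / 2) ^ 2 := by
    gcongr
  have l23 : 4 * Real.sin (Real.pi / N / 2) ^ 2 ≤ 4 * Real.sin ((Real.pi + δ) / N / 2) ^ 2 := by
    have : 0 ≤ Real.sin (Real.pi / N / 2) := by linarith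
    gcongr
  have b2 : Real.sin ((Real.pi + δ) / N / 2) ≤ (Real.pi + δ) / N / 2 :=
    (Real.sin_lt (by linarith)).le
  have b1 : Real.sin ((Real.pi - δ) / N / 2) ≤ (Real.pi - δ) / N / 2 :=
    (Real.sin_lt t1).le
  have bd : Real.sin ((Real.pi + δ) / N / 2) - Real.sin ((Real.pi - δ) / N / 2) ≤ δ / N := by
    have := (abs_le.1 (Real.abs_sin_sub_sin_le ((Real.pi + δ) / N / 2) ((Real.pi - δ) / N / 2))).2
    have e : (Real.pi + δ) / N / 2 - (Real.pi - δ) / N / 2 = δ / N := by ring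
    rw [e, abs_of_pos (by positivity)] at this
    simpa only [e] using (by
      have h := le_of_abs_le (Real.abs_sin_sub_sin_le ((Real.pi + δ) / N / 2) ((Real.pi - δ) / N / 2))
      rwa [e, abs_of_pos (by positivity)] at h)
  set A := Real.sin ((Real.pi + δ) / N / 2)
  set B := Real.sin ((Real.pi - δ) / N / 2)
  set M := Real.sin (Real.pi / N / 2)
  have nA : N * A ≤ (Real.pi + δ) / 2 := by
    calc N * A ≤ N * ((Real.pi + δ) / N / 2) := by gcongr
      _ = _ := by field_simp
  have nB : N * B ≤ (Real.pi - δ) / 2 := by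
    calc N * B ≤ N * ((Real.pi - δ) / N / 2) := by gcongr
      _ = _ := by field_simp
  have nd : N * (A - B) ≤ δ := by
    calc N * (A - B) ≤ N * (δ / N) := by gcongr
      _ = _ := by field_simp
  have nA0 : 0 ≤ N * A := mul_nonneg hNp.le (by linarith)
  have nB0 : 0 ≤ N * B := mul_nonneg hNp.le (by linarith)
  refine ⟨le_trans (by positivity) g1, ?_, ?_⟩
  · calc (N : ℝ) ^ 2 * spectralGap N c ≤ (N : ℝ) ^ 2 * (4 * A ^ 2) := by gcongr
      _ = 4 * (N * A) ^ 2 := by ring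
      _ ≤ 25 := by nlinarith
  · have : |spectralGap N c - 4 * M ^ 2| ≤ 4 * A ^ 2 - 4 * B ^ 2 := by
      rw [abs_le]; constructor <;> linarith
    calc (N : ℝ) ^ 2 * |spectralGap N c - 4 * M ^ 2| ≤ (N : ℝ) ^ 2 * (4 * A ^ 2 - 4 * B ^ 2) := by
          gcongr
      _ = 4 * (N * (A - B)) * (N * A + N * B) := by ring
      _ ≤ 4 * δ * 4 := by
          have : 0 ≤ N * (A - B) := mul_nonneg hNp.le (by linarith)
          gcongr
          linarith
      _ = _ := by ring

theorem uniform_close (c : ℕ → ℕ → ℝ) (g : ℕ → ℕ → ℝ)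
    (hc : ∀ N, 2 ≤ N → ∀ x, 1 ≤ x → x ≤ N - 1 → 0 < c N x)
    (hLLN : LLN (fun N x => 1 / c N x))
    (hg : ∀ N, 2 ≤ N → ∀ x ∈ Finset.Icc 1 N,
      gen N (c N) (g N) x = -(spectralGap N (c N)) * g N x)
    (hg1 : ∀ N, 2 ≤ N → g N 1 = 1) (e : ℝ) (he : 0 < e) :
    ∃ N₀ : ℕ, 2 ≤ N₀ ∧ ∀ N ≥ N₀, ∀ x, 1 ≤ x → x ≤ N →
      |g N x - hfun N x| < e ∧
      (2 ≤ x → |(N : ℝ) * c N (x - 1) * (g N x - g N (x - 1)) -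
          (N : ℝ) * (hfun N x - hfun N (x - 1))| < e) := by
  have p3 := Real.pi_gt_three
  have p4 := Real.pi_lt_d2
  set C := 20000 * Real.exp 27 with hC
  have hC0 : 0 < C := by positivity
  set δ := min (1 / 2) (e / (64 * C)) with hδ
  have hδ0 : 0 < δ := by positivity
  have hδ1 : δ < 1 := lt_of_le_of_lt (min_le_left _ _) (by norm_num)
  have hδe : 16 * (C * δ) ≤ e / 4 := by
    have : δ ≤ e / (64 * C) := min_le_right _ _
    rw [le_div_iff₀ (by positivity)] at this
    linarith
  have sd0 : 0 < Real.sin δ := Real.sin_pos_of_pos_of_lt_pi hδ0 (by linarith)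
  set η := min 1 (min (e / (8 * C)) (Real.sin δ / (8 * C))) with hη
  have hη0 : 0 < η := by positivity
  have hη1 : η ≤ 1 := min_le_left _ _
  have hηe : C * η ≤ e / 8 := by
    have : η ≤ e / (8 * C) := (min_le_right _ _).trans (min_le_left _ _)
    rw [le_div_iff₀ (by positivity)] at this
    linarith
  have hηs : C * η ≤ Real.sin δ / 8 := by
    have : η ≤ Real.sin δ / (8 * C) := (min_le_right _ _).trans (min_le_right _ _)
    rw [le_div_iff₀ (by positivity)] at this
    linarith
  obtain ⟨N₁, hN₁⟩ := hLLN η hη0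
  obtain ⟨N₂, hN₂⟩ := exists_nat_gt (5 / η)
  refine ⟨max 2 (max N₁ N₂), le_max_left _ _, ?_⟩
  intro N hN
  have hN2 : 2 ≤ N := (le_max_left _ _).trans hN
  have hNN1 : N₁ ≤ N := (le_max_left _ _).trans ((le_max_right _ _).trans hN)
  have hNN2 : N₂ ≤ N := (le_max_right _ _).trans ((le_max_right _ _).trans hN)
  have hNp : (0 : ℝ) < N := by exact_mod_cast (by omega : 0 < N)
  have h5 : 5 / (N : ℝ) ≤ η := by
    have : (N₂ : ℝ) ≤ N := by exact_mod_cast hNN2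
    rw [div_lt_iff₀ hη0] at hN₂
    rw [div_le_iff₀ hNp]
    nlinarith
  have hR : ∀ i < N, |∑ j ∈ Finset.range i, 1 / c N (j + 1) - (i : ℝ)| ≤ η * N := by
    intro i hi
    rcases Nat.eq_zero_or_pos i with h0 | h0
    · subst h0; simp; positivity
    · have := hN₁ N hNN1 1 (i + 1) le_rfl (by omega) (by omega)
      unfold rsum at this
      rw [Finset.sum_Ico_eq_sum_range] at this
      simp only [Nat.add_sub_cancel] at this
      push_cast at this
      rw [add_sub_cancel_right] at this
      simpa only [add_comm 1] using this
  have hsm : C * (η + 0 + 5 / N) < Real.sin δ / 2 := by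
    have : C * (5 / N) ≤ C * η := by gcongr
    linarith
  obtain ⟨w0, w1, w2⟩ := gap_close N hN2 (c N) δ η hη0.le hη1 hδ0 hδ1 (hc N hN2) hR hsm
  have hcl := shoot_close N (by omega) (fun i => 1 / c N (i + 1)) (Real.pi / N)
    (spectralGap N (c N)) η (16 * δ) hη0.le hη1
    (fun i hi => one_div_pos.2 (hc N hN2 _ (by omega) (by omega))) hR (by positivity)
    (by field_simp; linarith) w0 w1 w2
  rw [← hC] at hcl
  have hfin : C * (η + 16 * δ + 5 / N) < e := by
    have : C * (5 / N) ≤ C * η := by gcongr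
    linarith
  obtain ⟨f1, -⟩ := shoot_of_eig N hN2 (c N) (g N) _ (hc N hN2) (hg N hN2)
  rw [hg1 N hN2] at f1
  intro x hx1 hx2
  constructor
  · obtain ⟨i, rfl⟩ : ∃ i, x = i + 1 := ⟨x - 1, by omega⟩
    have q := (hcl i (by omega)).1
    rw [(f1 i (by omega)).1, one_mul]
    have : hfun N (i + 1) = Real.cos (Real.pi / N * (i + 1 / 2)) := by
      unfold hfun; congr 1; push_cast; ring
    rw [this]
    linarith
  · intro hx
    obtain ⟨i, rfl⟩ : ∃ i, x = i + 1 + 1 := ⟨x - 2, by omega⟩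
    have q := (hcl i (by omega)).2
    have q2 := (f1 (i + 1) (by omega)).2
    rw [if_neg (by omega), one_mul] at q2
    simp only [Nat.add_sub_cancel]
    rw [mul_assoc, q2]
    have : (N : ℝ) * (hfun N (i + 1 + 1) - hfun N (i + 1)) =
        -(2 * N * Real.sin (Real.pi / N / 2) * Real.sin (Real.pi / N * ((i + 1 : ℕ) : ℝ))) := by
      unfold hfun
      have e1 : Real.pi * (((i + 1 + 1 : ℕ) : ℝ) - 1 / 2) / N =
        Real.pi / N * ((i + 1 : ℕ) : ℝ) + Real.pi / N / 2 := by push_cast; ring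
      have e2 : Real.pi * (((i + 1 : ℕ) : ℝ) - 1 / 2) / N =
        Real.pi / N * ((i + 1 : ℕ) : ℝ) - Real.pi / N / 2 := by push_cast; ring
      rw [e1, e2, Real.cos_add, Real.cos_sub]
      ring
    rw [this]
    linarith

theorem one_le_tau1 (N : ℕ) (hN : 1 ≤ N) (r : ℕ → ℝ) (α : ℝ) : 1 ≤ tau1 N r α := by
  unfold tau1
  split_ifs with h
  · exact (Finset.mem_Icc.1 (Finset.mem_filter.1 (Finset.min'_mem _ h)).1).1
  · exact hN

theorem tau2_le (N : ℕ) (hN : 1 ≤ N) (r : ℕ → ℝ) (α : ℝ) : tau2 N r α ≤ N := by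
  unfold tau2
  split_ifs with h
  · exact (Finset.mem_Icc.1 (Finset.mem_filter.1 (Finset.max'_mem _ h)).1).2
  · exact hN

/-- Shape and weighted derivative of the principal eigenfunction on the second
segment `⟦τ₁, τ₂⟧`, with `α_N = N²·gap_N` and `r^{(N)} = 1/c^{(N)}`. -/
theorem eigenfunction_second_segment (c : ℕ → ℕ → ℝ) (g : ℕ → ℕ → ℝ)
    (hc : ∀ N, 2 ≤ N → ∀ x, 1 ≤ x → x ≤ N - 1 → 0 < c N x)
    (hLLN : LLN (fun N x => 1 / c N x))
    (hg : ∀ N, 2 ≤ N → ∀ x ∈ Finset.Icc 1 N,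
      gen N (c N) (g N) x = -(spectralGap N (c N)) * g N x)
    (hg1 : ∀ N, 2 ≤ N → g N 1 = 1) :
    (∀ ε > (0 : ℝ), ∃ N₀ : ℕ, ∀ N ≥ N₀, ∀ x : ℕ,
      tau1 N (fun y => 1 / c N y) ((N : ℝ) ^ 2 * spectralGap N (c N)) ≤ x →
      x ≤ tau2 N (fun y => 1 / c N y) ((N : ℝ) ^ 2 * spectralGap N (c N)) →
        |g N x - hfun N x| < ε) ∧
    (∀ ε > (0 : ℝ), ∃ N₀ : ℕ, ∀ N ≥ N₀, ∀ x : ℕ,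
      max 2 (tau1 N (fun y => 1 / c N y) ((N : ℝ) ^ 2 * spectralGap N (c N))) ≤ x →
      x ≤ tau2 N (fun y => 1 / c N y) ((N : ℝ) ^ 2 * spectralGap N (c N)) →
        |(N : ℝ) * c N (x - 1) * (g N x - g N (x - 1)) -
          (N : ℝ) * (hfun N x - hfun N (x - 1))| < ε) := by
  constructor
  · intro ε hε
    obtain ⟨N₀, h2, h⟩ := uniform_close c g hc hLLN hg hg1 ε hε
    refine ⟨N₀, fun N hN x hx1 hx2 => (h N hN x ?_ ?_).1⟩
    · exact (one_le_tau1 N (by omega) _ _).trans hx1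
    · exact hx2.trans (tau2_le N (by omega) _ _)
  · intro ε hε
    obtain ⟨N₀, h2, h⟩ := uniform_close c g hc hLLN hg hg1 ε hε
    refine ⟨N₀, fun N hN x hx1 hx2 => (h N hN x ?_ ?_).2 ?_⟩
    · exact (by norm_num : 1 ≤ 2).trans ((le_max_left _ _).trans hx1)
    · exact hx2.trans (tau2_le N (by omega) _ _)
    · exact (le_max_left _ _).trans hx1
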